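/- In ℝ², let K := {(x₁,x₂) ∈ ℝ² : x₁² + x₂² ≤ 1 and x₂ ≤ 5|x₁|}. There exists s₁ ∈ (0,1) such that Per_s(K,ℝ²) > Per_s(B₁,ℝ²) for every s ∈ [s₁,1), where B₁ is the open unit ball centered at the origin. -/

import Mathlib

open MeasureTheory Filter
open scoped ENNReal NNReal

noncomputable section

/-- The fractional kernel `|x - y| ^ (-n - s)`. -/
def fracKernel (n : ℕ) (s : ℝ) (x y : EuclideanSpace ℝ (Fin n)) : ℝ :=
  dist x y ^ (-(n : ℝ) - s)

/-- The cross-shaped domain `Q(Ω) = (ℝⁿ × ℝⁿ) \ (𝒞Ω × 𝒞Ω)`. -/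
def crossQ (n : ℕ) (Ω : Set (EuclideanSpace ℝ (Fin n))) :
    Set (EuclideanSpace ℝ (Fin n) × EuclideanSpace ℝ (Fin n)) :=
  (Ωᶜ ×ˢ Ωᶜ)ᶜ

/-- The fractional `s`-perimeter `Per_s(E, Ω)` of `E` in `Ω`. -/
def fracPer (n : ℕ) (s : ℝ) (E Ω : Set (EuclideanSpace ℝ (Fin n))) : ℝ≥0∞ :=
  (1 / 2) * ∫⁻ p in crossQ n Ω,
    ENNReal.ofReal
      (|Set.indicator E (fun _ => (1 : ℝ)) p.1 - Set.indicator E (fun _ => (1 : ℝ)) p.2| *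
        fracKernel n s p.1 p.2)

/-- The set `K = {x₁² + x₂² ≤ 1 and x₂ ≤ 5|x₁|} ⊆ ℝ²`. -/
def Kset : Set (EuclideanSpace ℝ (Fin 2)) :=
  {x | x 0 ^ 2 + x 1 ^ 2 ≤ 1 ∧ x 1 ≤ 5 * |x 0|}

/-- The open unit ball `B₁ ⊆ ℝ²` centered at the origin. -/
def Bone : Set (EuclideanSpace ℝ (Fin 2)) := Metric.ball 0 1

/-- The open ball `B₂ ⊆ ℝ²` of radius `2` centered at the origin. -/
def Btwo : Set (EuclideanSpace ℝ (Fin 2)) := Metric.ball 0 2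

/-- The open set `Ω = B₂ \ K`. -/
def Ωex : Set (EuclideanSpace ℝ (Fin 2)) := Btwo \ Kset

abbrev E2 := EuclideanSpace ℝ (Fin 2)

/-- The kernel as a function of the difference. -/
def fker (s : ℝ) (h : E2) : ℝ≥0∞ := ENNReal.ofReal (‖h‖ ^ (-(2:ℝ) - s))

lemma measurable_fker (s : ℝ) : Measurable (fker s) := by
  unfold fker; fun_prop

def coordMap (x : E2) : ℝ × ℝ := (x 0, x 1)

lemma coordMap_mp : MeasurePreserving coordMap volume volume :=
  (volume_preserving_finTwoArrow ℝ).comp (PiLp.volume_preserving_ofLp (Fin 2))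

lemma coordMap_swap_mp : MeasurePreserving (fun x : E2 => (x 1, x 0)) volume volume :=
  (Measure.measurePreserving_swap (μ := (volume : Measure ℝ)) (ν := (volume : Measure ℝ))).comp coordMap_mp

lemma norm_E2 (x : E2) : ‖x‖ = √(x 0 ^ 2 + x 1 ^ 2) := by
  rw [EuclideanSpace.norm_eq]; simp [Fin.sum_univ_two]

lemma norm_sq_E2 (x : E2) : ‖x‖ ^ 2 = x 0 ^ 2 + x 1 ^ 2 := by
  rw [norm_E2, Real.sq_sqrt (by positivity)]

lemma measurableSet_Kset : MeasurableSet Kset := by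
  have h1 : MeasurableSet {x : E2 | x 0 ^ 2 + x 1 ^ 2 ≤ 1} :=
    measurableSet_le (by fun_prop) (by fun_prop)
  have h2 : MeasurableSet {x : E2 | x 1 ≤ 5 * |x 0|} :=
    measurableSet_le (by fun_prop) (by fun_prop)
  exact h1.inter h2

lemma meas_region_eq (f g : ℝ → ℝ) (hf : Continuous f) (hg : Continuous g) (a b : ℝ) (hab : a ≤ b)
    (hfg : ∀ x ∈ Set.Ioc a b, f x ≤ g x) :
    volume {x : E2 | x 1 ∈ Set.Ioc a b ∧ x 0 ∈ Set.Ioo (f (x 1)) (g (x 1))} =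
      ENNReal.ofReal (∫ t in a..b, (g t - f t)) := by
  have h1 := volume_regionBetween_eq_integral (μ := (volume : Measure ℝ)) (s := Set.Ioc a b)
    (f := f) (g := g)
    (hf.integrableOn_Ioc) (hg.integrableOn_Ioc) measurableSet_Ioc hfg
  rw [intervalIntegral.integral_of_le hab]
  simp only [Pi.sub_apply] at h1
  rw [← h1]
  have := coordMap_swap_mp.measure_preimage (s := regionBetween f g (Set.Ioc a b))
    (measurableSet_regionBetween hf.measurable hg.measurable measurableSet_Ioc).nullMeasurableSet
  rw [Measure.volume_eq_prod] at this
  rw [← this]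
  rfl

lemma volume_V : volume (Bone \ Kset) ≤ ENNReal.ofReal (1/5) := by
  have h := meas_region_eq (fun t => -t/5) (fun t => t/5) (by fun_prop) (by fun_prop) 0 1
    (by norm_num) (by intro x hx; have := hx.1; linarith)
  have e : (∫ t in (0:ℝ)..1, (t/5 - -t/5)) = 1/5 := by
    have : ∀ t : ℝ, t/5 - -t/5 = (2/5) * t := by intro t; ring
    simp only [this]
    rw [intervalIntegral.integral_const_mul, integral_id]; norm_num
  rw [e] at h
  rw [← h]
  apply measure_mono
  rintro x ⟨hx, hk⟩
  have hx1 : ‖x‖ < 1 := by simpa [Bone] using hx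
  have hs := norm_sq_E2 x
  have hs1 : x 0 ^ 2 + x 1 ^ 2 < 1 := by rw [← hs]; nlinarith [norm_nonneg x]
  have h5 : 5 * |x 0| < x 1 := by
    by_contra hc
    exact hk ⟨hs1.le, not_lt.1 hc⟩
  have := abs_nonneg (x 0)
  have := le_abs_self (x 0)
  have := neg_abs_le (x 0)
  refine ⟨⟨by linarith, by nlinarith [sq_nonneg (x 0)]⟩, ?_, ?_⟩ <;> dsimp only <;> linarith

lemma lower_meas (h : E2) (hh : ‖h‖ < 1/100) :
    ENNReal.ofReal ((9/10) * (|h 0| + h 1 / 5)) ≤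
      volume {x : E2 | x ∈ Kset ∧ x + h ∈ Bone \ Kset} := by
  have h01 : |h 0| < 1/100 := lt_of_le_of_lt (by simpa using PiLp.norm_apply_le h 0) hh
  have h11 : |h 1| < 1/100 := lt_of_le_of_lt (by simpa using PiLp.norm_apply_le h 1) hh
  set l := |h 0| + h 1 / 5 with hl
  rcases le_or_gt l 0 with hl0 | hl0
  · rw [ENNReal.ofReal_of_nonpos (by linarith)]; exact zero_le
  have hlu : l < 1/50 := by have := le_abs_self (h 1); linarith
  have h11a := abs_lt.1 h11
  have tr : volume {x : E2 | x ∈ Kset ∧ x + h ∈ Bone \ Kset} =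
      volume {z : E2 | z - h ∈ Kset ∧ z ∈ Bone \ Kset} := by
    have := measure_preimage_add_right (volume : Measure E2) h
      {z : E2 | z - h ∈ Kset ∧ z ∈ Bone \ Kset}
    rw [← this]; simp [Set.preimage]
  rw [tr]
  rcases le_total (h 0) 0 with hs | hs
  · rw [abs_of_nonpos hs] at hl h01
    have e := meas_region_eq (fun t => t/5 - l) (fun t => t/5) (by fun_prop) (by fun_prop)
      (1/20) (19/20) (by norm_num) (by intro x hx; linarith)
    have e2 : (∫ t in (1/20:ℝ)..(19/20), (t/5 - (t/5 - l))) = 9/10 * l := by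
      simp; norm_num
    rw [e2] at e
    rw [← e]
    apply measure_mono
    rintro z ⟨⟨a1, a2⟩, b1, b2⟩
    dsimp only at b1 b2
    have c1 : z 0 ^ 2 + z 1 ^ 2 < 97/100 := by
      have : z 0 ^2 ≤ (19/100)^2 := by apply sq_le_sq'  <;> linarith
      nlinarith
    have nz := norm_sq_E2 z
    refine ⟨⟨?_, ?_⟩, ?_, ?_⟩
    · simp only [PiLp.sub_apply]
      nlinarith
    · simp only [PiLp.sub_apply]
      have := le_abs_self (z 0 - h 0)
      linarith
    · simp only [Bone, Metric.mem_ball, dist_zero_right]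
      nlinarith [norm_nonneg z]
    · rintro ⟨-, k2⟩
      have : |z 0| < z 1 / 5 := abs_lt.2 ⟨by linarith, by linarith⟩
      linarith
  · rw [abs_of_nonneg hs] at hl h01
    have e := meas_region_eq (fun t => -t/5) (fun t => -t/5 + l) (by fun_prop) (by fun_prop)
      (1/20) (19/20) (by norm_num) (by intro x hx; linarith)
    have e2 : (∫ t in (1/20:ℝ)..(19/20), (-t/5 + l - (-t/5))) = 9/10 * l := by
      simp; norm_num
    rw [e2] at e
    rw [← e]
    apply measure_mono
    rintro z ⟨⟨a1, a2⟩, b1, b2⟩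
    dsimp only at b1 b2
    have c1 : z 0 ^ 2 + z 1 ^ 2 < 97/100 := by
      have : z 0 ^2 ≤ (19/100)^2 := by apply sq_le_sq'  <;> linarith
      nlinarith
    have nz := norm_sq_E2 z
    refine ⟨⟨?_, ?_⟩, ?_, ?_⟩
    · simp only [PiLp.sub_apply]
      nlinarith
    · simp only [PiLp.sub_apply]
      have := neg_abs_le (z 0 - h 0)
      linarith
    · simp only [Bone, Metric.mem_ball, dist_zero_right]
      nlinarith [norm_nonneg z]
    · rintro ⟨-, k2⟩
      have : |z 0| < z 1 / 5 := abs_lt.2 ⟨by linarith, by linarith⟩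
      linarith

open scoped Pointwise in
/-- Points of a star-shaped subset of the unit ball which leave the ball after a translation. -/
lemma upper_meas (A : Set E2) (hA : A ⊆ Bone) (hAm : MeasurableSet A)
    (hstar : ∀ r : ℝ, 0 < r → r ≤ 1 → r • A ⊆ A) (c : ℝ)
    (hAc : volume A ≤ ENNReal.ofReal c) (h : E2) :
    volume {x : E2 | x ∈ A ∧ x + h ∉ Bone} ≤ ENNReal.ofReal (c * min 1 (2 * ‖h‖)) := by
  rcases le_or_gt 1 (2 * ‖h‖) with h1 | h1
  · rw [min_eq_left h1, mul_one]
    exact (measure_mono (fun x hx => hx.1)).trans hAc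
  rw [min_eq_right h1.le]
  set r := 1 - ‖h‖ with hr
  have hn := norm_nonneg h
  have hr0 : 0 < r := by linarith
  have hr1 : r ≤ 1 := by linarith
  have sub : {x : E2 | x ∈ A ∧ x + h ∉ Bone} ⊆ A \ (r • A) := by
    rintro x ⟨hx, hxB⟩
    refine ⟨hx, ?_⟩
    rintro ⟨y, hy, rfl⟩
    apply hxB
    have hy1 : ‖y‖ < 1 := by simpa [Bone] using hA hy
    simp only [Bone, Metric.mem_ball, dist_zero_right]
    calc ‖r • y + h‖ ≤ ‖r • y‖ + ‖h‖ := norm_add_le _ _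
      _ = r * ‖y‖ + ‖h‖ := by rw [norm_smul, Real.norm_of_nonneg hr0.le]
      _ < 1 := by nlinarith
  have hfin : volume A ≠ ∞ := ne_top_of_le_ne_top ENNReal.ofReal_ne_top hAc
  have hm : volume (r • A) = ENNReal.ofReal (r ^ 2) * volume A := by
    rw [Measure.addHaar_smul_of_nonneg _ hr0.le]; simp
  calc _ ≤ volume (A \ (r • A)) := measure_mono sub
    _ = volume A - volume (r • A) := by
        rw [measure_sdiff (hstar r hr0 hr1) (hAm.const_smul_of_ne_zero hr0.ne').nullMeasurableSet]
        rw [hm]; exact ENNReal.mul_ne_top ENNReal.ofReal_ne_top hfin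
    _ ≤ ENNReal.ofReal (2 * ‖h‖) * volume A := by
        rw [hm, tsub_le_iff_right, ← add_mul, ← ENNReal.ofReal_add (by positivity) (by positivity)]
        conv_lhs => rw [← one_mul (volume A)]
        gcongr
        rw [← ENNReal.ofReal_one]
        apply ENNReal.ofReal_le_ofReal
        nlinarith [sq_nonneg ‖h‖]
    _ ≤ ENNReal.ofReal (2 * ‖h‖) * ENNReal.ofReal c := by gcongr
    _ = _ := by rw [← ENNReal.ofReal_mul (by positivity), mul_comm]
lemma lintegral_polar (f : ℝ × ℝ → ℝ≥0∞) (hf : Measurable f) :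
    ∫⁻ h : E2, f (h 0, h 1) =
      ∫⁻ p in (Set.Ioi (0:ℝ)) ×ˢ (Set.Ioo (-Real.pi) Real.pi),
        ENNReal.ofReal p.1 * f (p.1 * Real.cos p.2, p.1 * Real.sin p.2) := by
  have h1 := coordMap_mp.lintegral_comp hf
  have h2 := lintegral_comp_polarCoord_symm f
  rw [← h2] at h1
  simpa [coordMap, polarCoord, smul_eq_mul] using h1

lemma lintegral_box (f g : ℝ → ℝ≥0∞) (hf : Measurable f) (hg : Measurable g) (S T : Set ℝ) :
    ∫⁻ p in S ×ˢ T, f p.1 * g p.2 = (∫⁻ r in S, f r) * ∫⁻ t in T, g t := by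
  rw [Measure.volume_eq_prod, ← Measure.prod_restrict]
  exact lintegral_prod_mul hf.aemeasurable hg.aemeasurable

lemma lint_rpow_zero (s b : ℝ) (hs : s < 1) (hb : 0 ≤ b) :
    ∫⁻ r in Set.Ioc 0 b, ENNReal.ofReal (r ^ (-s)) = ENNReal.ofReal (b ^ (1 - s) / (1 - s)) := by
  have hi := (intervalIntegral.intervalIntegrable_rpow' (a := 0) (b := b) (r := -s) (by linarith))
  have hi' := (intervalIntegrable_iff_integrableOn_Ioc_of_le hb).1 hi
  rw [← ofReal_integral_eq_lintegral_ofReal hi', ← intervalIntegral.integral_of_le hb,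
    integral_rpow (Or.inl (by linarith))]
  · rw [Real.zero_rpow (by linarith)]
    congr 1
    rw [sub_zero, neg_add_eq_sub]
  · refine (ae_restrict_iff' measurableSet_Ioc).2 (Eventually.of_forall fun x hx => ?_)
    exact Real.rpow_nonneg hx.1.le _

lemma lint_rpow_inf (s : ℝ) (hs : 0 < s) :
    ∫⁻ r in Set.Ioi 1, ENNReal.ofReal (r ^ (-1-s)) = ENNReal.ofReal (1 / s) := by
  have hi := integrableOn_Ioi_rpow_of_lt (a := -1-s) (c := 1) (by linarith) one_pos
  rw [← ofReal_integral_eq_lintegral_ofReal hi, integral_Ioi_rpow_of_lt (by linarith) one_pos]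
  · rw [Real.one_rpow]
    congr 1
    have : -1 - s + 1 = -s := by ring
    rw [this, neg_div_neg_eq]
  · refine (ae_restrict_iff' measurableSet_Ioi).2 (Eventually.of_forall fun x hx => ?_)
    exact Real.rpow_nonneg (zero_le_one.trans (le_of_lt hx)) _

lemma upper_int (s c : ℝ) (hs0 : 0 < s) (hs1 : s < 1) (hc : 0 ≤ c) :
    ∫⁻ h : E2, fker s h * ENNReal.ofReal (c * min 1 (2 * ‖h‖)) ≤
      ENNReal.ofReal (2 * Real.pi * c * (2 / (1 - s) + 1 / s)) := by
  have hpi := Real.pi_pos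
  have e := lintegral_polar (fun p => ENNReal.ofReal ((√(p.1^2+p.2^2)) ^ (-(2:ℝ) - s)) *
    ENNReal.ofReal (c * min 1 (2 * √(p.1^2+p.2^2)))) (by fun_prop)
  simp only [← norm_E2] at e
  unfold fker
  rw [e]
  have hpt : ∀ p ∈ (Set.Ioi (0:ℝ)) ×ˢ (Set.Ioo (-Real.pi) Real.pi),
      ENNReal.ofReal p.1 * (ENNReal.ofReal ((√((p.1 * Real.cos p.2)^2+(p.1 * Real.sin p.2)^2)) ^ (-(2:ℝ) - s)) *
    ENNReal.ofReal (c * min 1 (2 * √((p.1 * Real.cos p.2)^2+(p.1 * Real.sin p.2)^2)))) =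
      ENNReal.ofReal (p.1 ^ (-1 - s) * (c * min 1 (2 * p.1))) * (fun _ => (1:ℝ≥0∞)) p.2 := by
    rintro ⟨r, t⟩ ⟨hr, -⟩
    have hr' : 0 < r := hr
    have : (r * Real.cos t)^2 + (r * Real.sin t)^2 = r^2 := by
      rw [mul_pow, mul_pow, ← mul_add, Real.cos_sq_add_sin_sq, mul_one]
    simp only [this, Real.sqrt_sq hr'.le, mul_one]
    rw [← ENNReal.ofReal_mul (by positivity), ← ENNReal.ofReal_mul (by positivity), ← mul_assoc]
    congr 2
    rw [show -1 - s = 1 + (-2 - s) by ring, Real.rpow_add hr', Real.rpow_one]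
  rw [setLIntegral_congr_fun (measurableSet_Ioi.prod measurableSet_Ioo) hpt,
    lintegral_box (fun r => ENNReal.ofReal (r ^ (-1 - s) * (c * min 1 (2 * r)))) (fun _ => 1)
      (by fun_prop) (by fun_prop)]
  have h2 : ∫⁻ t in Set.Ioo (-Real.pi) Real.pi, (1:ℝ≥0∞) = ENNReal.ofReal (2 * Real.pi) := by
    rw [setLIntegral_one, Real.volume_Ioo]; congr 1; ring
  rw [h2, ← Set.Ioc_union_Ioi_eq_Ioi (zero_le_one' ℝ)]
  have h3 : ∫⁻ r in Set.Ioc (0:ℝ) 1, ENNReal.ofReal (r ^ (-1 - s) * (c * min 1 (2 * r))) ≤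
      ENNReal.ofReal (2 * c) * ENNReal.ofReal (1 / (1 - s)) := by
    have := lint_rpow_zero s 1 hs1 zero_le_one
    rw [Real.one_rpow] at this
    rw [← this, ← lintegral_const_mul _ (by fun_prop)]
    apply setLIntegral_mono (by fun_prop)
    intro r hr
    rw [← ENNReal.ofReal_mul (by positivity)]
    apply ENNReal.ofReal_le_ofReal
    have hr0 : 0 < r := hr.1
    rw [show -s = 1 + (-1 - s) by ring, Real.rpow_add hr0, Real.rpow_one]
    calc _ ≤ r ^ (-1 - s) * (c * (2 * r)) := by gcongr; exact min_le_right _ _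
      _ = _ := by ring
  have h4 : ∫⁻ r in Set.Ioi (1:ℝ), ENNReal.ofReal (r ^ (-1 - s) * (c * min 1 (2 * r))) ≤
      ENNReal.ofReal c * ENNReal.ofReal (1 / s) := by
    rw [← lint_rpow_inf s hs0, ← lintegral_const_mul _ (by fun_prop)]
    apply setLIntegral_mono (by fun_prop)
    intro r hr
    have hr0 : 0 < r := zero_lt_one.trans hr
    rw [← ENNReal.ofReal_mul (by positivity)]
    apply ENNReal.ofReal_le_ofReal
    calc _ ≤ r ^ (-1 - s) * (c * 1) := by gcongr; exact min_le_left _ _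
      _ = _ := by ring
  have h1s : 0 < 1 - s := by linarith
  calc _ ≤ (ENNReal.ofReal (2 * c) * ENNReal.ofReal (1 / (1 - s)) +
        ENNReal.ofReal c * ENNReal.ofReal (1 / s)) * ENNReal.ofReal (2 * Real.pi) := by
        gcongr
        exact (lintegral_union_le _ _ _).trans (add_le_add h3 h4)
    _ = _ := by
        rw [← ENNReal.ofReal_mul (by positivity), ← ENNReal.ofReal_mul (by positivity),
          ← ENNReal.ofReal_add (by positivity) (by positivity), ← ENNReal.ofReal_mul (by positivity)]
        congr 1
        ring

lemma ofReal_integral_le (f : ℝ → ℝ) (hf : Continuous f) (a b : ℝ) (hab : a ≤ b) :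
    ENNReal.ofReal (∫ t in a..b, f t) ≤ ∫⁻ t in Set.Ioo a b, ENNReal.ofReal (f t) := by
  have h1 : ∫ t in a..b, f t ≤ ∫ t in a..b, max (f t) 0 :=
    intervalIntegral.integral_mono_on hab (hf.intervalIntegrable _ _)
      ((hf.max continuous_const).intervalIntegrable _ _) (fun x _ => le_max_left _ _)
  refine (ENNReal.ofReal_le_ofReal h1).trans ?_
  rw [intervalIntegral.integral_of_le hab, ofReal_integral_eq_lintegral_ofReal
    (f := fun t => max (f t) 0) (hf.max continuous_const).integrableOn_Ioc
    (Eventually.of_forall fun x => le_max_right _ _), restrict_Ioo_eq_restrict_Ioc]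
  apply le_of_eq
  congr 1; ext t
  rcases le_total (f t) 0 with h | h
  · rw [max_eq_right h, ENNReal.ofReal_of_nonpos h, ENNReal.ofReal_zero]
  · rw [max_eq_left h]

lemma lower_int (s d : ℝ) (hs1 : s < 1) (hd : 0 < d) :
    ENNReal.ofReal ((9/10) * Real.pi * (d ^ (1 - s) / (1 - s))) ≤
    ∫⁻ h : E2, fker s h * (if ‖h‖ ≤ d then ENNReal.ofReal ((9/10) * (|h 0| + h 1 / 5)) else 0) := by
  have hpi := Real.pi_pos
  have h1s : 0 < 1 - s := by linarith
  have e := lintegral_polar (fun p => ENNReal.ofReal ((√(p.1^2+p.2^2)) ^ (-(2:ℝ) - s)) *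
    (if √(p.1^2+p.2^2) ≤ d then ENNReal.ofReal ((9/10) * (|p.1| + p.2 / 5)) else 0))
    (by
      refine Measurable.mul (by fun_prop) (Measurable.ite ?_ (by fun_prop) (by fun_prop))
      exact measurableSet_le (by fun_prop) (by fun_prop))
  simp only [← norm_E2] at e
  unfold fker
  rw [e]
  have hang : ENNReal.ofReal ((9/10) * Real.pi) ≤ ∫⁻ t in Set.Ioo (-Real.pi) Real.pi,
      ENNReal.ofReal ((9/10) * (Real.cos t ^ 2 + Real.sin t / 5)) := by
    refine le_trans (le_of_eq ?_) (ofReal_integral_le _ (by fun_prop) _ _ (by linarith))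
    congr 1
    rw [intervalIntegral.integral_const_mul, intervalIntegral.integral_add
      (Continuous.intervalIntegrable (by fun_prop) _ _)
      (Continuous.intervalIntegrable (by fun_prop) _ _), integral_cos_sq,
      intervalIntegral.integral_div, integral_sin]
    simp
  have hrad := lint_rpow_zero s d hs1 hd.le
  calc _ = ENNReal.ofReal (d ^ (1 - s) / (1 - s)) * ENNReal.ofReal ((9/10) * Real.pi) := by
        rw [← ENNReal.ofReal_mul (by positivity), mul_comm]
    _ ≤ (∫⁻ r in Set.Ioc 0 d, ENNReal.ofReal (r ^ (-s))) * ∫⁻ t in Set.Ioo (-Real.pi) Real.pi,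
      ENNReal.ofReal ((9/10) * (Real.cos t ^ 2 + Real.sin t / 5)) := by
        rw [hrad]; gcongr
    _ = ∫⁻ p in Set.Ioc 0 d ×ˢ Set.Ioo (-Real.pi) Real.pi, ENNReal.ofReal (p.1 ^ (-s)) *
      ENNReal.ofReal ((9/10) * (Real.cos p.2 ^ 2 + Real.sin p.2 / 5)) :=
        (lintegral_box (fun r => ENNReal.ofReal (r ^ (-s))) (fun t =>
          ENNReal.ofReal ((9/10) * (Real.cos t ^ 2 + Real.sin t / 5)))
          (by fun_prop) (by fun_prop) _ _).symm
    _ ≤ ∫⁻ p in Set.Ioc 0 d ×ˢ Set.Ioo (-Real.pi) Real.pi, _ := by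
        apply setLIntegral_mono' (measurableSet_Ioc.prod measurableSet_Ioo)
        rintro ⟨r, t⟩ ⟨⟨hr, hrd⟩, -⟩
        have hr' : 0 < r := hr
        have hrd' : r ≤ d := hrd
        have h3 : (r * Real.cos t)^2 + (r * Real.sin t)^2 = r^2 := by
          rw [mul_pow, mul_pow, ← mul_add, Real.cos_sq_add_sin_sq, mul_one]
        simp only [h3, Real.sqrt_sq hr'.le, if_pos hrd']
        rw [← ENNReal.ofReal_mul (by positivity), ← ENNReal.ofReal_mul (by positivity),
          ← ENNReal.ofReal_mul (by positivity)]
        apply ENNReal.ofReal_le_ofReal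
        rw [show -s = 1 + (1 + (-2 - s)) by ring, Real.rpow_add hr', Real.rpow_add hr', Real.rpow_one,
          abs_mul, abs_of_pos hr']
        have hcs : Real.cos t ^ 2 ≤ |Real.cos t| := by
          rw [← sq_abs]; nlinarith [abs_nonneg (Real.cos t), Real.abs_cos_le_one t]
        calc _ = r * (r ^ (-2 - s) * (9/10 * (r * Real.cos t ^ 2 + r * Real.sin t / 5))) := by ring
          _ ≤ _ := by gcongr
    _ ≤ _ := lintegral_mono_set (Set.prod_mono Set.Ioc_subset_Ioi_self le_rfl)
lemma fracPer_eq (s : ℝ) (A : Set E2) (hA : MeasurableSet A) (hfin : volume A ≠ ∞) :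
    fracPer 2 s A Set.univ = ∫⁻ h : E2, fker s h * volume {x : E2 | x ∈ A ∧ x + h ∉ A} := by
  have hm1 : Measurable (Set.indicator A (fun _ => (1 : ℝ))) := measurable_const.indicator hA
  have hF : Measurable (fun p : E2 × E2 => ENNReal.ofReal
      (|Set.indicator A (fun _ => (1 : ℝ)) p.1 - Set.indicator A (fun _ => (1 : ℝ)) p.2| *
        fracKernel 2 s p.1 p.2)) := by
    unfold fracKernel
    refine Measurable.ennreal_ofReal (Measurable.mul (Measurable.abs
      ((hm1.comp measurable_fst).sub (hm1.comp measurable_snd))) ?_)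
    fun_prop
  unfold fracPer
  have hQ : crossQ 2 (Set.univ : Set E2) = Set.univ := by simp [crossQ]
  rw [hQ, Measure.restrict_univ, Measure.volume_eq_prod, lintegral_prod _ hF.aemeasurable]
  have h1 : ∀ x : E2, ∫⁻ y : E2, ENNReal.ofReal
      (|Set.indicator A (fun _ => (1 : ℝ)) x - Set.indicator A (fun _ => (1 : ℝ)) y| *
        fracKernel 2 s x y) = ∫⁻ h : E2, ENNReal.ofReal
      (|Set.indicator A (fun _ => (1 : ℝ)) x - Set.indicator A (fun _ => (1 : ℝ)) (x + h)| *
        fracKernel 2 s x (x + h)) := fun x =>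
    (lintegral_add_left_eq_self (μ := (volume : Measure E2)) (fun y => ENNReal.ofReal
      (|Set.indicator A (fun _ => (1 : ℝ)) x - Set.indicator A (fun _ => (1 : ℝ)) y| *
        fracKernel 2 s x y)) x).symm
  simp only [h1]
  rw [lintegral_lintegral_swap]
  swap
  · exact (hF.comp (measurable_fst.prodMk (measurable_fst.add measurable_snd))).aemeasurable
  rw [← lintegral_const_mul']
  swap
  · simp
  congr 1
  ext h
  have hS1 : MeasurableSet {x : E2 | x ∈ A ∧ x + h ∉ A} :=
    hA.inter ((measurable_add_const h) hA).compl
  have hS2 : MeasurableSet {x : E2 | x ∉ A ∧ x + h ∈ A} :=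
    hA.compl.inter ((measurable_add_const h) hA)
  have hS3 : MeasurableSet {x : E2 | x ∈ A ∧ x + h ∈ A} :=
    hA.inter ((measurable_add_const h) hA)
  set S1 := {x : E2 | x ∈ A ∧ x + h ∉ A} with hd1
  set S2 := {x : E2 | x ∉ A ∧ x + h ∈ A} with hd2
  set S3 := {x : E2 | x ∈ A ∧ x + h ∈ A} with hd3
  have v1 : volume S1 + volume S3 = volume A := by
    rw [← measure_union _ hS3]
    · congr 1; ext x; simp only [hd1, hd3, Set.mem_union, Set.mem_ofPred_eq]; tauto
    · rw [Set.disjoint_left]; rintro x ⟨-, h1⟩ ⟨-, h2⟩; exact h1 h2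
  have v2 : volume S2 + volume S3 = volume A := by
    rw [← measure_preimage_add_right (volume : Measure E2) h A, ← measure_union _ hS3]
    · congr 1; ext x
      simp only [hd2, hd3, Set.mem_union, Set.mem_ofPred_eq, Set.mem_preimage]; tauto
    · rw [Set.disjoint_left]; rintro x ⟨h1, -⟩ ⟨h2, -⟩; exact h1 h2
  have v3 : volume S3 ≠ ∞ := ne_top_of_le_ne_top hfin (measure_mono fun x hx => hx.1)
  have v12 : volume S1 = volume S2 := by
    rw [← v2] at v1
    exact (ENNReal.add_left_inj v3).1 v1
  have hpt : ∀ x : E2, ENNReal.ofReal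
      (|Set.indicator A (fun _ => (1 : ℝ)) x - Set.indicator A (fun _ => (1 : ℝ)) (x + h)| *
        fracKernel 2 s x (x + h)) =
      fker s h * (S1.indicator (fun _ => 1) x + S2.indicator (fun _ => 1) x) := by
    intro x
    have hk : fracKernel 2 s x (x + h) = ‖h‖ ^ (-(2:ℝ) - s) := by
      simp [fracKernel]
    rw [hk, fker]
    by_cases p : x ∈ A <;> by_cases q : x + h ∈ A <;> simp [hd1, hd2, p, q]
  simp only [hpt]
  have hi1 : Measurable (S1.indicator (fun _ => (1:ℝ≥0∞))) := measurable_const.indicator hS1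
  have hi2 : Measurable (S2.indicator (fun _ => (1:ℝ≥0∞))) := measurable_const.indicator hS2
  rw [lintegral_const_mul' (fker s h) _ ENNReal.ofReal_ne_top, lintegral_add_left hi1, lintegral_indicator hS1,
    lintegral_indicator hS2, setLIntegral_one, setLIntegral_one, ← v12, ← two_mul,
    mul_left_comm (fker s h), ← mul_assoc, one_div, ENNReal.inv_mul_cancel (by simp) (by simp),
    one_mul]

lemma smul_Bone (r : ℝ) (hr : 0 < r) (hr1 : r ≤ 1) (x : E2) (hx : x ∈ Bone) : r • x ∈ Bone := by
  simp only [Bone, Metric.mem_ball, dist_zero_right] at *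
  rw [norm_smul, Real.norm_of_nonneg hr.le]
  nlinarith [norm_nonneg x]

open scoped Pointwise in
lemma star_V (r : ℝ) (hr : 0 < r) (hr1 : r ≤ 1) : r • (Bone \ Kset) ⊆ Bone \ Kset := by
  rintro _ ⟨x, ⟨hx, hk⟩, rfl⟩
  refine ⟨smul_Bone r hr hr1 x hx, ?_⟩
  rintro ⟨-, h2⟩
  apply hk
  have hx1 : ‖x‖ < 1 := by simpa [Bone] using hx
  have hs := norm_sq_E2 x
  refine ⟨by rw [← hs]; nlinarith [norm_nonneg x], ?_⟩
  simp only [PiLp.smul_apply, smul_eq_mul, abs_mul, abs_of_pos hr] at h2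
  have : r * x 1 ≤ r * (5 * |x 0|) := by linarith
  exact le_of_mul_le_mul_left this hr

lemma choose_s : ∃ s₁ : ℝ, s₁ ∈ Set.Ioo (0 : ℝ) 1 ∧ ∀ s ∈ Set.Ico s₁ (1 : ℝ),
    2 * Real.pi * (1/5) * (2 / (1 - s) + 1 / s) <
      (9/10) * Real.pi * ((1/200:ℝ) ^ (1 - s) / (1 - s)) := by
  have hc : ContinuousAt (fun s : ℝ => (9/10) * (1/200:ℝ) ^ (1 - s) - (2/5) * (1 - s) / s) 1 := by
    have h1 : ContinuousAt (fun s : ℝ => (1/200:ℝ) ^ (1 - s)) 1 :=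
      ContinuousAt.rpow continuousAt_const (by fun_prop) (Or.inl (by norm_num))
    exact (continuousAt_const.mul h1).sub (ContinuousAt.div (by fun_prop) (by fun_prop) one_ne_zero)
  have hev : ∀ᶠ s in nhds (1:ℝ), (4/5 : ℝ) < (9/10) * (1/200:ℝ) ^ (1 - s) - (2/5) * (1 - s) / s := by
    apply hc.eventually_const_lt
    norm_num
  obtain ⟨e, he, hb⟩ := Metric.eventually_nhds_iff.1 hev
  refine ⟨max (1/2) (1 - e/2), ⟨by positivity, max_lt (by norm_num) (by linarith)⟩, ?_⟩
  rintro s ⟨h1, h2⟩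
  have h3 : 1/2 ≤ s := (le_max_left _ _).trans h1
  have h4 : 1 - e/2 ≤ s := (le_max_right _ _).trans h1
  have := hb (y := s) (by rw [Real.dist_eq, abs_lt]; constructor <;> linarith)
  have hs : 0 < 1 - s := by linarith
  have hs0 : 0 < s := by linarith
  have hpi := Real.pi_pos
  have e1 : 2 * Real.pi * (1/5) * (2 / (1 - s) + 1 / s) =
      Real.pi / (1 - s) * (4/5 + (2/5) * (1 - s) / s) := by field_simp; ring
  have e2 : (9/10) * Real.pi * ((1/200:ℝ) ^ (1 - s) / (1 - s)) =
      Real.pi / (1 - s) * ((9/10) * (1/200:ℝ) ^ (1 - s)) := by ring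
  rw [e1, e2]
  apply mul_lt_mul_of_pos_left _ (by positivity)
  linarith

theorem exists_s₁_sPerimeter_K_gt_ball :
    ∃ s₁ : ℝ, s₁ ∈ Set.Ioo (0 : ℝ) 1 ∧
      ∀ s ∈ Set.Ico s₁ (1 : ℝ),
        fracPer 2 s Bone Set.univ < fracPer 2 s Kset Set.univ := by
  obtain ⟨s₁, hs₁, H⟩ := choose_s
  refine ⟨s₁, hs₁, fun s hs => ?_⟩
  have hlt := H s hs
  have hs0 : 0 < s := hs₁.1.trans_le hs.1
  have hs1 : s < 1 := hs.2
  have hBm : MeasurableSet Bone := Metric.isOpen_ball.measurableSet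
  have hKm := measurableSet_Kset
  have hKcl : Kset ⊆ Metric.closedBall (0:E2) 1 := by
    rintro x ⟨hx, -⟩
    have := norm_sq_E2 x
    simp only [Metric.mem_closedBall, dist_zero_right]
    nlinarith [norm_nonneg x]
  have hKfin : volume Kset ≠ ∞ :=
    ((measure_mono hKcl).trans_lt measure_closedBall_lt_top).ne
  rw [fracPer_eq s _ hBm measure_ball_lt_top.ne, fracPer_eq s _ hKm hKfin]
  set M : E2 → ℝ≥0∞ := fun h =>
    volume {x : E2 | x ∈ Kset ∩ Bone ∧ x + h ∉ Metric.closedBall (0:E2) 1} with hM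
  set U : E2 → ℝ≥0∞ := fun h => ENNReal.ofReal ((1/5) * min 1 (2 * ‖h‖)) with hU
  set L : E2 → ℝ≥0∞ := fun h =>
    if ‖h‖ ≤ 1/200 then ENNReal.ofReal ((9/10) * (|h 0| + h 1 / 5)) else 0 with hL
  have hBcl : Bone ⊆ Metric.closedBall (0:E2) 1 := Metric.ball_subset_closedBall
  have hB : ∀ h : E2, volume {x : E2 | x ∈ Bone ∧ x + h ∉ Bone} ≤ M h + U h := by
    intro h
    have hsph : volume {x : E2 | x + h ∈ Metric.sphere (0:E2) 1} = 0 := by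
      have := measure_preimage_add_right (volume : Measure E2) h (Metric.sphere (0:E2) 1)
      rw [Measure.addHaar_sphere] at this
      exact this
    have hu := upper_meas (Bone \ Kset) Set.sdiff_subset (hBm.diff hKm)
      (fun r => star_V r) (1/5) volume_V h
    calc _ ≤ volume (({x : E2 | x ∈ Kset ∩ Bone ∧ x + h ∉ Metric.closedBall (0:E2) 1} ∪
          {x : E2 | x ∈ Bone \ Kset ∧ x + h ∉ Bone}) ∪ {x : E2 | x + h ∈ Metric.sphere (0:E2) 1}) := by
          apply measure_mono
          rintro x ⟨hx, hxh⟩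
          by_cases hk : x ∈ Kset
          · by_cases hsp : x + h ∈ Metric.sphere (0:E2) 1
            · exact Or.inr hsp
            · refine Or.inl (Or.inl ⟨⟨hk, hx⟩, fun hc => ?_⟩)
              rw [← Metric.ball_union_sphere] at hc
              exact hc.elim hxh hsp
          · exact Or.inl (Or.inr ⟨⟨hx, hk⟩, hxh⟩)
      _ ≤ (M h + volume {x : E2 | x ∈ Bone \ Kset ∧ x + h ∉ Bone}) + 0 := by
          rw [← hsph]
          exact (measure_union_le _ _).trans (add_le_add_left (measure_union_le _ _) _)
      _ ≤ M h + U h := by rw [add_zero]; gcongr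
  have hK : ∀ h : E2, M h + L h ≤ volume {x : E2 | x ∈ Kset ∧ x + h ∉ Kset} := by
    intro h
    have hl : L h ≤ volume {x : E2 | x ∈ Kset ∧ x + h ∈ Bone \ Kset} := by
      simp only [hL]
      split_ifs with hh
      · exact lower_meas h (by linarith)
      · exact zero_le
    calc _ ≤ M h + volume {x : E2 | x ∈ Kset ∧ x + h ∈ Bone \ Kset} := by gcongr
      _ = volume ({x : E2 | x ∈ Kset ∩ Bone ∧ x + h ∉ Metric.closedBall (0:E2) 1} ∪
          {x : E2 | x ∈ Kset ∧ x + h ∈ Bone \ Kset}) := by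
          rw [measure_union]
          · rw [Set.disjoint_left]
            rintro x ⟨-, h1⟩ ⟨-, h2, -⟩
            exact h1 (hBcl h2)
          · exact hKm.inter ((measurable_add_const h) (hBm.diff hKm))
      _ ≤ _ := by
          apply measure_mono
          rintro x (⟨h1, h2⟩ | ⟨h1, h2⟩)
          · exact ⟨h1.1, fun hc => h2 (hKcl hc)⟩
          · exact ⟨h1, h2.2⟩
  have hfin : ∫⁻ h, fker s h * M h ≠ ∞ := by
    have hv : volume Bone ≠ ∞ := measure_ball_lt_top.ne
    have hle : ∫⁻ h, fker s h * M h ≤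
        ∫⁻ h : E2, fker s h * ENNReal.ofReal ((volume Bone).toReal * min 1 (2 * ‖h‖)) := by
      apply lintegral_mono
      intro h
      dsimp only
      gcongr
      refine le_trans (measure_mono ?_) (upper_meas Bone le_rfl hBm ?_ _
        (ENNReal.ofReal_toReal hv).ge h)
      · rintro x ⟨h1, h2⟩
        exact ⟨h1.2, fun hc => h2 (hBcl hc)⟩
      · rintro r hr hr1 _ ⟨x, hx, rfl⟩
        exact smul_Bone r hr hr1 x hx
    exact ne_top_of_le_ne_top ENNReal.ofReal_ne_top
      (hle.trans (upper_int s _ hs0 hs1 ENNReal.toReal_nonneg))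
  have hUm : Measurable (fun h => fker s h * U h) := by
    have := measurable_fker s
    simp only [hU]; fun_prop
  have hpos : 0 < (9/10) * Real.pi * ((1/200:ℝ) ^ (1 - s) / (1 - s)) := by
    have := Real.pi_pos
    have : 0 < 1 - s := by linarith
    positivity
  calc _ ≤ ∫⁻ h, (fker s h * M h + fker s h * U h) := by
        apply lintegral_mono
        intro h
        dsimp only
        rw [← mul_add]
        gcongr
        exact hB h
    _ = (∫⁻ h, fker s h * M h) + ∫⁻ h, fker s h * U h := lintegral_add_right _ hUm
    _ ≤ (∫⁻ h, fker s h * M h) + ENNReal.ofReal (2 * Real.pi * (1/5) * (2 / (1 - s) + 1 / s)) := by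
        gcongr
        exact upper_int s (1/5) hs0 hs1 (by norm_num)
    _ < (∫⁻ h, fker s h * M h) +
        ENNReal.ofReal ((9/10) * Real.pi * ((1/200:ℝ) ^ (1 - s) / (1 - s))) :=
        ENNReal.add_lt_add_left hfin ((ENNReal.ofReal_lt_ofReal_iff hpos).2 hlt)
    _ ≤ (∫⁻ h, fker s h * M h) + ∫⁻ h, fker s h * L h := by
        gcongr
        exact lower_int s (1/200) hs1 (by norm_num)
    _ ≤ ∫⁻ h, (fker s h * M h + fker s h * L h) := le_lintegral_add _ _
    _ ≤ _ := by
        apply lintegral_mono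
        intro h
        dsimp only
        rw [← mul_add]
        gcongr
        exact hK h

end
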